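/- Let K be an imaginary quadratic field. Then there exists a nonzero complex number Ω_K such that f(z) ∈ 𝔔̄ · Ω_K^k for every z ∈ K ∩ ℍ, every integer k, and every holomorphic modular form f of weight k for some finite-index subgroup of SL(2,ℤ) all of whose Fourier coefficients (in the expansion f(τ) = ∑_{n≥0} a_n e^{2πinτ/h}, h the width of the cusp i∞ for the subgroup) are algebraic numbers; here 𝔔̄ denotes the field of algebraic numbers. -/

import Mathlib

open Complex

noncomputable section

abbrev SL2Z := Matrix.SpecialLinearGroup (Fin 2) ℤ

/-- Möbius action of `SL(2,ℤ)`: `γ·τ = (aτ+b)/(cτ+d)`. -/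
def acts (γ : SL2Z) (τ : ℂ) : ℂ :=
  ((γ.1 0 0 : ℂ) * τ + (γ.1 0 1 : ℂ)) / ((γ.1 1 0 : ℂ) * τ + (γ.1 1 1 : ℂ))

section PartOne

open UpperHalfPlane ModularForm ModularFormClass MatrixGroups EisensteinSeries

/-- The monomial `E₄^a E₆^b` as a function on the upper half plane. -/
def eisMono (p : ℕ × ℕ) : ℍ → ℂ := fun z => E₄ z ^ p.1 * E₆ z ^ p.2

/-- The span of the monomials of weight `k`. -/
def eisSpan (k : ℤ) : Submodule ℂ (ℍ → ℂ) :=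
  Submodule.span ℂ (Set.image eisMono {p | 4 * (p.1 : ℤ) + 6 * (p.2 : ℤ) = k})

lemma disc_mul_eisSpan (k : ℤ) (u : ℍ → ℂ) (hu : u ∈ eisSpan (k - 12)) :
    (fun z => discriminant z * u z) ∈ eisSpan k := by
  unfold eisSpan at hu
  induction hu using Submodule.span_induction with
  | mem x hx =>
    obtain ⟨p, hp, rfl⟩ := hx
    have h1 : eisMono (p.1 + 3, p.2) ∈ eisSpan k :=
      Submodule.subset_span ⟨_, by simp only [Set.mem_ofPred_eq] at hp ⊢; push_cast; linarith, rfl⟩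
    have h2 : eisMono (p.1, p.2 + 2) ∈ eisSpan k :=
      Submodule.subset_span ⟨_, by simp only [Set.mem_ofPred_eq] at hp ⊢; push_cast; linarith, rfl⟩
    have h3 := Submodule.smul_mem _ (1 / 1728 : ℂ) (Submodule.sub_mem _ h1 h2)
    convert h3 using 1
    ext z
    simp only [eisMono, discriminant_eq_E₄_cube_sub_E₆_sq z, Pi.smul_apply, Pi.sub_apply,
      smul_eq_mul]
    ring
  | zero => convert Submodule.zero_mem _ using 1; ext z; simp
  | add x y _ _ hx hy =>
    convert Submodule.add_mem _ hx hy using 1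
    ext z; simp [mul_add]
  | smul c x _ hx =>
    convert Submodule.smul_mem _ c hx using 1
    ext z; simp; ring

lemma exists_mono_form (k : ℤ) (a b : ℕ) (h : 4 * (a : ℤ) + 6 * (b : ℤ) = k) :
    ∃ g : ModularForm 𝒮ℒ k, (g : ℍ → ℂ) = eisMono (a, b) ∧ (qExpansion 1 g).coeff 0 = 1 := by
  refine ⟨ModularForm.mcast (by rw [← h]; ring) ((E₄.pow a).mul (E₆.pow b)), ?_, ?_⟩
  · ext z
    simp [eisMono]
  · simp only [coe_mcast]
    rw [ModularForm.qExpansion_mul one_pos one_mem_strictPeriods_SL,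
      ModularForm.qExpansion_pow one_pos one_mem_strictPeriods_SL,
      ModularForm.qExpansion_pow one_pos one_mem_strictPeriods_SL]
    have h4 := E_qExpansion_coeff_zero (by norm_num : 3 ≤ 4) ⟨2, rfl⟩
    have h6 := E_qExpansion_coeff_zero (by norm_num : 3 ≤ 6) ⟨3, rfl⟩
    rw [PowerSeries.coeff_zero_eq_constantCoeff] at *
    rw [map_mul, map_pow, map_pow]
    erw [h4, h6]
    simp

lemma exists_weights (n : ℕ) (h : 4 ≤ n) (he : Even n) : ∃ a b : ℕ, 4 * a + 6 * b = n := by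
  obtain ⟨m, hm⟩ := he
  rcases Nat.even_or_odd m with ⟨l, hl⟩ | ⟨l, hl⟩
  · exact ⟨l, 0, by omega⟩
  · exact ⟨l - 1, 1, by omega⟩

theorem levelOne_mem_eisSpan_nat (n : ℕ) : ∀ f : ModularForm 𝒮ℒ (n : ℤ),
    (f : ℍ → ℂ) ∈ eisSpan n := by
  induction n using Nat.strong_induction_on with
  | _ n ih =>
  intro f
  rcases Nat.even_or_odd n with he | ho
  swap
  · rw [levelOne_odd_weight_eq_zero (by exact_mod_cast ho) f]
    exact Submodule.zero_mem _
  by_cases h4 : 4 ≤ n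
  · obtain ⟨a, b, hab⟩ := exists_weights n h4 he
    obtain ⟨g, hg, hg1⟩ := exists_mono_form (n : ℤ) a b (by exact_mod_cast hab)
    have hc : IsCuspForm (f - (qExpansion 1 f).coeff 0 • g) := by
      rw [isCuspForm_iff_coeffZero_eq_zero, FunLike.coe_sub,
        ModularForm.qExpansion_sub one_pos one_mem_strictPeriods_SL, FunLike.coe_smul,
        ModularForm.qExpansion_smul one_pos one_mem_strictPeriods_SL, map_sub,
        PowerSeries.coeff_smul, hg1]
      simp
    obtain ⟨c, hc⟩ := hc
    have hc' : (c : ℍ → ℂ) = f - (qExpansion 1 f).coeff 0 • g := congrArg DFunLike.coe hc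
    have hd : (fun z => discriminant z * (CuspForm.discriminantEquiv c) z) ∈ eisSpan n := by
      apply disc_mul_eisSpan
      by_cases h12 : 12 ≤ n
      · have key := ih (n - 12) (by omega)
        have e : ((n - 12 : ℕ) : ℤ) = (n : ℤ) - 12 := by omega
        rw [e] at key
        exact key _
      · rw [levelOne_neg_weight_eq_zero (by omega)]
        exact Submodule.zero_mem _
    have hf : (f : ℍ → ℂ) = (fun z => discriminant z * (CuspForm.discriminantEquiv c) z)
        + (qExpansion 1 f).coeff 0 • eisMono (a, b) := by
      ext z
      have := congrFun hc' z
      simp only [discriminant_mul_discriminantEquiv_apply, Pi.add_apply, this, ← hg, Pi.sub_apply,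
        Pi.smul_apply]
      ring
    rw [hf]
    exact Submodule.add_mem _ hd (Submodule.smul_mem _ _
      (Submodule.subset_span ⟨_, by simpa using (by exact_mod_cast hab), rfl⟩))
  · have : n = 0 ∨ n = 2 := by
      obtain ⟨m, hm⟩ := he
      omega
    rcases this with rfl | rfl
    · obtain ⟨c, hc⟩ := levelOne_weight_zero_const f
      rw [hc]
      have : eisMono (0, 0) ∈ eisSpan 0 := Submodule.subset_span ⟨_, by simp, rfl⟩
      have e : (Function.const ℍ c : ℍ → ℂ) = c • eisMono (0, 0) := by
        funext z; simp [eisMono]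
      rw [e]
      exact Submodule.smul_mem _ c this
    · have h0 : Module.rank ℂ (ModularForm 𝒮ℒ 2) = 0 := levelOne_weight_two_rank_zero
      rw [rank_zero_iff_forall_zero] at h0
      rw [show f = 0 from h0 f]
      exact Submodule.zero_mem _

theorem levelOne_mem_eisSpan (k : ℤ) (f : ModularForm 𝒮ℒ k) : (f : ℍ → ℂ) ∈ eisSpan k := by
  rcases lt_or_ge k 0 with h | h
  · rw [levelOne_neg_weight_eq_zero h]
    exact Submodule.zero_mem _
  · obtain ⟨n, rfl⟩ := Int.eq_ofNat_of_zero_le h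
    exact levelOne_mem_eisSpan_nat n f

end PartOne

section PartTwo

open UpperHalfPlane ModularForm ModularFormClass MatrixGroups EisensteinSeries

/-- The automorphy factor `cτ+d`. -/
def den (γ : SL2Z) (τ : ℂ) : ℂ := (γ.1 1 0 : ℂ) * τ + (γ.1 1 1 : ℂ)

lemma coe_smul_eq_acts (γ : SL2Z) (z : ℍ) : ((γ • z : ℍ) : ℂ) = acts γ z := by
  rw [UpperHalfPlane.specialLinearGroup_apply]
  simp [acts]

lemma denom_eq_den (γ : SL2Z) (z : ℍ) : UpperHalfPlane.denom γ z = den γ z := by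
  simp [UpperHalfPlane.denom, den]

lemma den_ne_zero (γ : SL2Z) (τ : ℂ) (h : 0 < τ.im) : den γ τ ≠ 0 := by
  have := UpperHalfPlane.denom_ne_zero γ ⟨τ, h⟩
  rwa [denom_eq_den] at this

lemma acts_im_pos (γ : SL2Z) (τ : ℂ) (h : 0 < τ.im) : 0 < (acts γ τ).im := by
  have := (γ • (⟨τ, h⟩ : ℍ)).im_pos
  rw [← UpperHalfPlane.coe_im, coe_smul_eq_acts] at this
  exact this

lemma acts_mul (γ δ : SL2Z) (τ : ℂ) (h : 0 < τ.im) :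
    acts (γ * δ) τ = acts γ (acts δ τ) := by
  have := congrArg UpperHalfPlane.coe (mul_smul γ δ (⟨τ, h⟩ : ℍ))
  simpa only [coe_smul_eq_acts] using this

lemma den_mul (γ δ : SL2Z) (τ : ℂ) (h : 0 < τ.im) :
    den (γ * δ) τ = den γ (acts δ τ) * den δ τ := by
  have hd := den_ne_zero δ τ h
  unfold acts
  unfold den at *
  simp only [Matrix.SpecialLinearGroup.coe_mul, Matrix.mul_apply, Fin.sum_univ_two]
  push_cast
  field_simp
  ring

lemma acts_one (τ : ℂ) : acts 1 τ = τ := by simp [acts]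

lemma den_one (τ : ℂ) : den 1 τ = 1 := by simp [den]

theorem mem_eisSpan_of_levelOne (w : ℤ) (c : ℂ → ℂ)
    (hol : ∀ τ : ℂ, 0 < τ.im → DifferentiableAt ℂ c τ)
    (htr : ∀ (γ : SL2Z) (τ : ℂ), 0 < τ.im → c (acts γ τ) = den γ τ ^ w * c τ)
    (hb : ∃ M A : ℝ, ∀ τ : ℂ, 0 < τ.im → A ≤ τ.im → ‖c τ‖ ≤ M) :
    (fun z : ℍ => c z) ∈ eisSpan w := by
  have hs : ∀ γ : SL2Z, (fun z : ℍ => c z) ∣[w] γ = fun z : ℍ => c z := by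
    intro γ
    ext z
    rw [SL_slash_apply, coe_smul_eq_acts, htr γ z z.im_pos, denom_eq_den, zpow_neg]
    have := zpow_ne_zero w (den_ne_zero γ z z.im_pos)
    field_simp
  let F : ModularForm 𝒮ℒ w :=
    { toFun := fun z : ℍ => c z
      slash_action_eq' := fun _ ⟨γ, hγ⟩ ↦ hγ ▸ hs γ
      holo' := by
        rw [UpperHalfPlane.mdifferentiable_iff]
        intro z hz
        have hz' : 0 < z.im := hz
        refine DifferentiableAt.differentiableWithinAt ?_
        refine (hol z hz').congr_of_eventuallyEq ?_
        filter_upwards [(isOpen_lt continuous_const Complex.continuous_im).mem_nhds hz'] with y hy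
        simp [UpperHalfPlane.ofComplex_apply_of_im_pos hy]
      bdd_at_cusps' := by
        intro d hd
        rw [OnePoint.isBoundedAt_iff_forall_SL2Z hd]
        intro γ _
        rw [hs γ, UpperHalfPlane.isBoundedAtImInfty_iff]
        obtain ⟨M, A, h⟩ := hb
        exact ⟨M, A, fun z hz => h z z.im_pos hz⟩ }
  exact levelOne_mem_eisSpan w F

end PartTwo

section PartThree

open UpperHalfPlane ModularForm ModularFormClass MatrixGroups EisensteinSeries

/-- The algebraic numbers inside `ℂ`. -/
abbrev Qbar : IntermediateField ℚ ℂ := algebraicClosure ℚ ℂ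

lemma mem_Qbar {x : ℂ} : x ∈ Qbar ↔ IsAlgebraic ℚ x := mem_algebraicClosure_iff

/-- The local parameter of width `h`. -/
def qw (h : ℕ) (τ : ℂ) : ℂ := Complex.exp (2 * (Real.pi : ℂ) * Complex.I * τ / (h : ℂ))

/-- `f` is given by the power series `p` in the parameter `qw h`. -/
def QE (h : ℕ) (f : ℂ → ℂ) (p : PowerSeries ℂ) : Prop :=
  ∀ τ : ℂ, 0 < τ.im → HasSum (fun n : ℕ => p.coeff n * qw h τ ^ n) (f τ)

/-- `f` has an expansion with algebraic coefficients. -/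
def QAlg (h : ℕ) (f : ℂ → ℂ) : Prop :=
  ∃ p : PowerSeries ℂ, (∀ n, p.coeff n ∈ Qbar) ∧ QE h f p

lemma QE.mul {h : ℕ} {f g : ℂ → ℂ} {p r : PowerSeries ℂ} (hf : QE h f p) (hg : QE h g r) :
    QE h (fun τ => f τ * g τ) (p * r) := by
  intro τ hτ
  have h1 := hf τ hτ
  have h2 := hg τ hτ
  have n1 := h1.summable.norm
  have n2 := h2.summable.norm
  have key := tsum_mul_tsum_eq_tsum_sum_antidiagonal_of_summable_norm n1 n2
  have hs := summable_norm_sum_mul_antidiagonal_of_summable_norm n1 n2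
  rw [h1.tsum_eq, h2.tsum_eq] at key
  have := hs.of_norm.hasSum
  rw [← key] at this
  convert! this using 1
  ext n
  rw [PowerSeries.coeff_mul, Finset.sum_mul]
  refine Finset.sum_congr rfl fun x hx => ?_
  rw [← Finset.HasAntidiagonal.mem_antidiagonal.mp hx, pow_add]
  ring

lemma QE.one (h : ℕ) : QE h (fun _ => 1) 1 := by
  intro τ _
  convert! hasSum_ite_eq (0 : ℕ) (1 : ℂ) using 1
  ext n
  rw [PowerSeries.coeff_one]
  split_ifs with hn <;> simp [hn]

lemma QE.smul {h : ℕ} {f : ℂ → ℂ} {p : PowerSeries ℂ} (c : ℂ) (hf : QE h f p) :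
    QE h (fun τ => c * f τ) (c • p) := by
  intro τ hτ
  convert! (hf τ hτ).mul_left c using 1
  ext n
  simp [mul_assoc]

lemma QE.add {h : ℕ} {f g : ℂ → ℂ} {p r : PowerSeries ℂ} (hf : QE h f p) (hg : QE h g r) :
    QE h (fun τ => f τ + g τ) (p + r) := by
  intro τ hτ
  convert! (hf τ hτ).add (hg τ hτ) using 1
  ext n
  simp [add_mul]

lemma QE.sum {ι : Type*} {h : ℕ} (S : Finset ι) (f : ι → ℂ → ℂ) (p : ι → PowerSeries ℂ)
    (hf : ∀ i ∈ S, QE h (f i) (p i)) : QE h (fun τ => ∑ i ∈ S, f i τ) (∑ i ∈ S, p i) := by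
  intro τ hτ
  convert! hasSum_sum (fun i hi => hf i hi τ hτ) using 1
  ext n
  rw [map_sum, Finset.sum_mul]

lemma QAlg.mul {h : ℕ} {f g : ℂ → ℂ} (hf : QAlg h f) (hg : QAlg h g) :
    QAlg h (fun τ => f τ * g τ) := by
  obtain ⟨p, hp, hf⟩ := hf
  obtain ⟨r, hr, hg⟩ := hg
  refine ⟨p * r, fun n => ?_, hf.mul hg⟩
  rw [PowerSeries.coeff_mul]
  exact sum_mem fun x _ => mul_mem (hp _) (hr _)

lemma QAlg.one (h : ℕ) : QAlg h (fun _ => 1) := by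
  refine ⟨1, fun n => ?_, QE.one h⟩
  rw [PowerSeries.coeff_one]
  split_ifs
  · exact one_mem _
  · exact zero_mem _

lemma QAlg.pow {h : ℕ} {f : ℂ → ℂ} (hf : QAlg h f) (n : ℕ) : QAlg h (fun τ => f τ ^ n) := by
  induction n with
  | zero => simpa using QAlg.one h
  | succ n ih => simpa only [pow_succ] using ih.mul hf

lemma qw_eq_qParam (h : ℕ) (τ : ℂ) : qw h τ = Function.Periodic.qParam (h : ℝ) τ := by
  simp [qw, Function.Periodic.qParam]

lemma cuspFunction_zero_fun (h : ℝ) : UpperHalfPlane.cuspFunction h (0 : ℍ → ℂ) = 0 := by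
  simpa [UpperHalfPlane.cuspFunction, Function.Periodic.cuspFunction]
    using! (tendsto_const_nhds.mono_left nhdsWithin_le_nhds).limUnder_eq

lemma QE.eq_zero {h : ℕ} (hh : 0 < h) {p : PowerSeries ℂ} (hp : QE h (fun _ => 0) p) : p = 0 := by
  have hh' : (0 : ℝ) < h := by exact_mod_cast hh
  have han : AnalyticAt ℂ (UpperHalfPlane.cuspFunction (h : ℝ) (0 : ℍ → ℂ)) 0 := by
    rw [cuspFunction_zero_fun]
    exact analyticAt_const
  have hs : ∀ τ : ℍ, HasSum (fun m ↦ p.coeff m • Function.Periodic.qParam (h : ℝ) τ ^ m)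
      ((0 : ℍ → ℂ) τ) := by
    intro τ
    have := hp τ τ.im_pos
    simp only [qw_eq_qParam] at this
    simpa only [smul_eq_mul, Pi.zero_apply] using this
  have h1 := UpperHalfPlane.hasFPowerSeriesOnBall_cuspFunction (f := (0 : ℍ → ℂ))
    (c := fun n => p.coeff n) hh' han hs
  rw [cuspFunction_zero_fun] at h1
  have h0 := h1.hasFPowerSeriesAt.eq_zero
  have h2 : ∀ n, p.coeff n = 0 := by
    intro n
    have h3 := congrArg (fun P => FormalMultilinearSeries.coeff P n) h0
    rw [FormalMultilinearSeries.coeff_ofScalars] at h3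
    exact h3
  exact PowerSeries.ext fun n => by rw [h2 n, map_zero]

/-- A `Qbar`-linear retraction `ℂ → Qbar`. -/
lemma exists_retraction : ∃ φ : ℂ →ₗ[Qbar] Qbar, ∀ x : Qbar, φ (x : ℂ) = x := by
  obtain ⟨φ, hφ⟩ := LinearMap.exists_leftInverse_of_injective (Algebra.linearMap Qbar ℂ)
    (LinearMap.ker_eq_bot.mpr (algebraMap Qbar ℂ).injective)
  exact ⟨φ, fun x => LinearMap.congr_fun hφ x⟩

/-- Descent of linear relations from `ℂ` to `Qbar`. -/
lemma descent {ι : Type*} {h : ℕ} (hh : 0 < h) (φ : ℂ →ₗ[Qbar] Qbar)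
    (hφ : ∀ x : Qbar, φ (x : ℂ) = x) (S : Finset ι) (C : ι → ℂ) (u : ι → ℂ → ℂ) (v : ℂ → ℂ)
    (hu : ∀ i ∈ S, QAlg h (u i)) (hv : QAlg h v)
    (hrel : ∀ τ : ℂ, 0 < τ.im → v τ + ∑ i ∈ S, C i * u i τ = 0) :
    ∀ τ : ℂ, 0 < τ.im → v τ + ∑ i ∈ S, (φ (C i) : ℂ) * u i τ = 0 := by
  classical
  choose! p hp hpu using hu
  obtain ⟨r, hr, hrv⟩ := hv
  have h1 : ∀ D : ι → ℂ, QE h (fun τ => v τ + ∑ i ∈ S, D i * u i τ) (r + ∑ i ∈ S, D i • p i) :=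
    fun D => hrv.add (QE.sum S _ _ fun i hi => (hpu i hi).smul (D i))
  have h2 : r + ∑ i ∈ S, C i • p i = 0 := by
    refine QE.eq_zero hh ?_
    intro τ hτ
    have := h1 C τ hτ
    simp only [hrel τ hτ] at this
    exact this
  have h3 : r + ∑ i ∈ S, (φ (C i) : ℂ) • p i = 0 := by
    ext n
    have h4 := congrArg (fun P => PowerSeries.coeff n P) h2
    simp only [map_add, map_sum, PowerSeries.coeff_smul, smul_eq_mul, map_zero] at h4 ⊢
    have h5 := congrArg (fun x => (φ x : ℂ)) h4
    simp only [map_add, map_sum, map_zero, AddMemClass.coe_add, AddSubmonoidClass.coe_finsetSum, ZeroMemClass.coe_zero] at h5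
    have e1 : (φ (r.coeff n) : ℂ) = r.coeff n := by
      exact congrArg Subtype.val (hφ ⟨_, hr n⟩)
    have e2 : ∀ i ∈ S, (φ (C i * (p i).coeff n) : ℂ) = (φ (C i) : ℂ) * (p i).coeff n := by
      intro i hi
      have := φ.map_smul (⟨_, hp i hi n⟩ : Qbar) (C i)
      have h6 := congrArg (fun x : Qbar => (x : ℂ)) this
      simp only [smul_eq_mul, MulMemClass.coe_mul] at h6
      rw [mul_comm, mul_comm (φ (C i) : ℂ)]
      exact h6
    rw [← Finset.sum_congr rfl e2]
    rw [e1] at h5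
    exact h5
  intro τ hτ
  have := h1 (fun i => (φ (C i) : ℂ)) τ hτ
  rw [h3] at this
  simpa using this.unique (by simp)

/-- `E₄` and `E₆` as functions on `ℂ`. -/
def e4 (τ : ℂ) : ℂ := E₄ (ofComplex τ)
def e6 (τ : ℂ) : ℂ := E₆ (ofComplex τ)

/-- Rescaling the parameter. -/
lemma QAlg.rescale {h a b : ℕ} (hh : 0 < h) (ha : 0 < a) (hb : 0 < b) {f : ℂ → ℂ}
    (hf : QAlg h f) (B : ℂ) (hBim : B.im = 0)
    (hB : Complex.exp (2 * (Real.pi : ℂ) * Complex.I * B / h) ∈ Qbar) :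
    QAlg (h * b) (fun τ => f (B + a / b * τ)) := by
  obtain ⟨p, hp, hf⟩ := hf
  set ζ := Complex.exp (2 * (Real.pi : ℂ) * Complex.I * B / h) with hζ
  refine ⟨PowerSeries.mk fun n => if a ∣ n then p.coeff (n / a) * ζ ^ (n / a) else 0, ?_, ?_⟩
  · intro n
    rw [PowerSeries.coeff_mk]
    split_ifs
    · exact mul_mem (hp _) (pow_mem hB _)
    · exact zero_mem _
  · intro τ hτ
    have him : 0 < (B + a / b * τ).im := by
      have e : ((a : ℂ) / b) = (((a : ℝ) / b : ℝ) : ℂ) := by push_cast; rfl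
      rw [e, Complex.add_im, Complex.im_ofReal_mul, hBim, zero_add]
      positivity
    have h1 := hf _ him
    have hw : qw h (B + a / b * τ) = ζ * qw (h * b) τ ^ a := by
      have hh' : (h : ℂ) ≠ 0 := by exact_mod_cast hh.ne'
      have hb' : (b : ℂ) ≠ 0 := by exact_mod_cast hb.ne'
      rw [hζ, qw, qw, ← Complex.exp_nat_mul, ← Complex.exp_add]
      congr 1
      push_cast
      field_simp
    have hinj : Function.Injective (fun n : ℕ => a * n) := fun x y hxy =>
      Nat.eq_of_mul_eq_mul_left ha hxy
    rw [← hinj.hasSum_iff]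
    · convert! h1 using 1
      ext n
      simp only [Function.comp, PowerSeries.coeff_mk, dvd_mul_right, if_true,
        Nat.mul_div_cancel_left _ ha, hw, mul_pow, ← pow_mul]
      ring
    · intro n hn
      have : ¬ a ∣ n := fun ⟨m, hm⟩ => hn ⟨m, hm.symm⟩
      simp [this]

lemma E_QAlg {k : ℕ} (hk : 3 ≤ k) (hk2 : Even k) :
    QAlg 1 (fun τ => E hk (ofComplex τ)) := by
  refine ⟨qExpansion 1 (E hk), fun n => ?_, ?_⟩
  · rw [E_qExpansion_coeff hk hk2]
    split_ifs
    · exact one_mem _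
    · refine mul_mem (neg_mem (div_mem (mul_mem (ofNat_mem _ 2) (natCast_mem _ _)) ?_))
        (natCast_mem _ _)
      exact mem_Qbar.mpr (isAlgebraic_algebraMap (R := ℚ) (A := ℂ) (bernoulli k))
  · intro τ hτ
    have := ModularForm.hasSum_qExpansion (f := E hk) one_pos one_mem_strictPeriods_SL ⟨τ, hτ⟩
    simp only [ofComplex_apply_of_im_pos hτ]
    simpa [qw_eq_qParam] using this

lemma e4_QAlg {h : ℕ} (hh : 0 < h) : QAlg h e4 := by
  have := (E_QAlg (by norm_num : 3 ≤ 4) ⟨2, rfl⟩).rescale one_pos hh hh 0 rfl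
    (by simp only [mul_zero, zero_div, Complex.exp_zero]; exact one_mem _)
  have hh' : (h : ℂ) ≠ 0 := by exact_mod_cast hh.ne'
  simp only [zero_add, div_self hh', one_mul] at this
  exact this

lemma e6_QAlg {h : ℕ} (hh : 0 < h) : QAlg h e6 := by
  have := (E_QAlg (by norm_num : 3 ≤ 6) ⟨3, rfl⟩).rescale one_pos hh hh 0 rfl
    (by simp only [mul_zero, zero_div, Complex.exp_zero]; exact one_mem _)
  have hh' : (h : ℂ) ≠ 0 := by exact_mod_cast hh.ne'
  simp only [zero_add, div_self hh', one_mul] at this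
  exact this

end PartThree

section PartFour

/-- Modular forms of weight `k` for `Γ`, as functions on `ℂ`. -/
structure IsMF (k : ℤ) (f : ℂ → ℂ) (Γ : Subgroup SL2Z) : Prop where
  hol : ∀ τ : ℂ, 0 < τ.im → DifferentiableAt ℂ f τ
  tr : ∀ γ ∈ Γ, ∀ τ : ℂ, 0 < τ.im → f (acts γ τ) = den γ τ ^ k * f τ
  bdd : ∀ γ : SL2Z, ∃ M A : ℝ, ∀ τ : ℂ, 0 < τ.im → A ≤ τ.im →
    ‖den γ τ ^ (-k) * f (acts γ τ)‖ ≤ M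

/-- The slash translate of `f` by `g⁻¹`. -/
def FF (k : ℤ) (f : ℂ → ℂ) (g : SL2Z) (τ : ℂ) : ℂ := den g⁻¹ τ ^ (-k) * f (acts g⁻¹ τ)

lemma FF_one (k : ℤ) (f : ℂ → ℂ) (τ : ℂ) : FF k f 1 τ = f τ := by
  simp [FF, den_one, acts_one]

lemma FF_mul_right {k : ℤ} {f : ℂ → ℂ} {Γ : Subgroup SL2Z} (hf : IsMF k f Γ) (g γ : SL2Z)
    (hγ : γ ∈ Γ) (τ : ℂ) (hτ : 0 < τ.im) : FF k f (g * γ) τ = FF k f g τ := by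
  unfold FF
  have h1 := acts_im_pos g⁻¹ τ hτ
  rw [mul_inv_rev, acts_mul _ _ _ hτ, den_mul _ _ _ hτ, hf.tr _ (inv_mem hγ) _ h1, mul_zpow]
  have h2 := zpow_ne_zero k (den_ne_zero γ⁻¹ _ h1)
  rw [zpow_neg (den γ⁻¹ (acts g⁻¹ τ))]
  field_simp

lemma FF_acts (k : ℤ) (f : ℂ → ℂ) (g σ : SL2Z) (τ : ℂ) (hτ : 0 < τ.im) :
    FF k f g (acts σ τ) = den σ τ ^ k * FF k f (σ⁻¹ * g) τ := by
  unfold FF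
  rw [mul_inv_rev, inv_inv, acts_mul _ _ _ hτ, den_mul _ _ _ hτ, mul_zpow, zpow_neg (den σ τ)]
  have h2 := zpow_ne_zero k (den_ne_zero σ _ hτ)
  field_simp

/-- The translates, indexed by cosets. -/
def FQ (k : ℤ) (f : ℂ → ℂ) {Γ : Subgroup SL2Z} (q : SL2Z ⧸ Γ) (τ : ℂ) : ℂ := FF k f q.out τ

lemma FQ_mk {k : ℤ} {f : ℂ → ℂ} {Γ : Subgroup SL2Z} (hf : IsMF k f Γ) (g : SL2Z)
    (τ : ℂ) (hτ : 0 < τ.im) : FQ k f (g : SL2Z ⧸ Γ) τ = FF k f g τ := by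
  obtain ⟨γ, hγ⟩ := QuotientGroup.mk_out_eq_mul Γ g
  rw [FQ, hγ, FF_mul_right hf _ _ γ.2 _ hτ]

lemma FQ_acts {k : ℤ} {f : ℂ → ℂ} {Γ : Subgroup SL2Z} (hf : IsMF k f Γ) (q : SL2Z ⧸ Γ) (σ : SL2Z)
    (τ : ℂ) (hτ : 0 < τ.im) : FQ k f q (acts σ τ) = den σ τ ^ k * FQ k f (σ⁻¹ • q) τ := by
  induction q using QuotientGroup.induction_on with
  | H g =>
    rw [FQ_mk hf _ _ (acts_im_pos _ _ hτ), FF_acts _ _ _ _ _ hτ, ← FQ_mk hf _ _ hτ]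
    rfl

lemma differentiableAt_acts (γ : SL2Z) (τ : ℂ) (hτ : 0 < τ.im) : DifferentiableAt ℂ (acts γ) τ := by
  have := den_ne_zero γ τ hτ
  unfold den at this
  unfold acts
  fun_prop (disch := assumption)

lemma FF_hol {k : ℤ} {f : ℂ → ℂ} {Γ : Subgroup SL2Z} (hf : IsMF k f Γ) (g : SL2Z)
    (τ : ℂ) (hτ : 0 < τ.im) : DifferentiableAt ℂ (FF k f g) τ := by
  unfold FF
  refine DifferentiableAt.mul ?_ ?_
  · refine DifferentiableAt.zpow ?_ (Or.inl (den_ne_zero _ _ hτ))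
    unfold den
    fun_prop
  · exact (hf.hol _ (acts_im_pos _ _ hτ)).comp τ (differentiableAt_acts _ _ hτ)

variable {k : ℤ} {f : ℂ → ℂ} {Γ : Subgroup SL2Z} [Fintype (SL2Z ⧸ Γ)]

/-- Elementary symmetric functions of the translates. -/
def sy (k : ℤ) (f : ℂ → ℂ) (Γ : Subgroup SL2Z) [Fintype (SL2Z ⧸ Γ)] (e : ℕ) (τ : ℂ) : ℂ :=
  ∑ t ∈ Finset.powersetCard e (Finset.univ : Finset (SL2Z ⧸ Γ)), ∏ q ∈ t, FQ k f q τ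

lemma sy_tr (hf : IsMF k f Γ) (e : ℕ) (σ : SL2Z) (τ : ℂ) (hτ : 0 < τ.im) :
    sy k f Γ e (acts σ τ) = den σ τ ^ (k * e) * sy k f Γ e τ := by
  unfold sy
  have h1 : ∀ t ∈ Finset.powersetCard e (Finset.univ : Finset (SL2Z ⧸ Γ)),
      ∏ q ∈ t, FQ k f q (acts σ τ) = den σ τ ^ (k * e) *
        ∏ q ∈ t.map (MulAction.toPerm (σ⁻¹) : Equiv.Perm (SL2Z ⧸ Γ)).toEmbedding, FQ k f q τ := by
    intro t ht
    rw [Finset.mem_powersetCard] at ht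
    simp_rw [FQ_acts hf _ σ τ hτ]
    rw [Finset.prod_mul_distrib, Finset.prod_const, ht.2, zpow_mul, zpow_natCast, Finset.prod_map]
    rfl
  rw [Finset.sum_congr rfl h1, ← Finset.mul_sum]
  congr 1
  have h2 : Finset.powersetCard e (Finset.univ : Finset (SL2Z ⧸ Γ)) =
      (Finset.powersetCard e (Finset.univ : Finset (SL2Z ⧸ Γ))).map (Finset.mapEmbedding
        (MulAction.toPerm (σ⁻¹) : Equiv.Perm (SL2Z ⧸ Γ)).toEmbedding).toEmbedding := by
    rw [← Finset.powersetCard_map, Finset.map_univ_equiv]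
  conv_rhs => rw [h2, Finset.sum_map]
  rfl

lemma FF_bdd (hf : IsMF k f Γ) (g : SL2Z) : ∃ M A : ℝ, ∀ τ : ℂ, 0 < τ.im → A ≤ τ.im →
    ‖FF k f g τ‖ ≤ M := hf.bdd g⁻¹

lemma bdd_prod {ι : Type*} (t : Finset ι) (u : ι → ℂ → ℂ)
    (h : ∀ i ∈ t, ∃ M A : ℝ, ∀ τ : ℂ, 0 < τ.im → A ≤ τ.im → ‖u i τ‖ ≤ M) :
    ∃ M A : ℝ, ∀ τ : ℂ, 0 < τ.im → A ≤ τ.im → ‖∏ i ∈ t, u i τ‖ ≤ M := by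
  classical
  induction t using Finset.induction_on with
  | empty => exact ⟨1, 0, by simp⟩
  | insert i t hi ih =>
    obtain ⟨M, A, h1⟩ := ih fun j hj => h j (Finset.mem_insert_of_mem hj)
    obtain ⟨M', A', h2⟩ := h i (Finset.mem_insert_self _ _)
    refine ⟨|M'| * |M|, max A A', fun τ hτ hA => ?_⟩
    rw [Finset.prod_insert hi, norm_mul]
    have a1 := (h1 τ hτ (le_trans (le_max_left _ _) hA)).trans (le_abs_self _)
    have a2 := (h2 τ hτ (le_trans (le_max_right _ _) hA)).trans (le_abs_self _)
    gcongr

lemma bdd_sum {ι : Type*} (t : Finset ι) (u : ι → ℂ → ℂ)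
    (h : ∀ i ∈ t, ∃ M A : ℝ, ∀ τ : ℂ, 0 < τ.im → A ≤ τ.im → ‖u i τ‖ ≤ M) :
    ∃ M A : ℝ, ∀ τ : ℂ, 0 < τ.im → A ≤ τ.im → ‖∑ i ∈ t, u i τ‖ ≤ M := by
  classical
  induction t using Finset.induction_on with
  | empty => exact ⟨0, 0, by simp⟩
  | insert i t hi ih =>
    obtain ⟨M, A, h1⟩ := ih fun j hj => h j (Finset.mem_insert_of_mem hj)
    obtain ⟨M', A', h2⟩ := h i (Finset.mem_insert_self _ _)
    refine ⟨M' + M, max A A', fun τ hτ hA => ?_⟩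
    rw [Finset.sum_insert hi]
    exact (norm_add_le _ _).trans (add_le_add (h2 τ hτ (le_trans (le_max_right _ _) hA))
      (h1 τ hτ (le_trans (le_max_left _ _) hA)))

lemma sy_mem (hf : IsMF k f Γ) (e : ℕ) :
    (fun z : UpperHalfPlane => sy k f Γ e z) ∈ eisSpan (k * e) := by
  refine mem_eisSpan_of_levelOne _ _ ?_ (fun σ τ hτ => sy_tr hf e σ τ hτ) ?_
  · intro τ hτ
    unfold sy
    refine DifferentiableAt.fun_sum fun t _ => DifferentiableAt.fun_finsetProd fun q _ => ?_
    exact FF_hol hf _ _ hτ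
  · exact bdd_sum _ _ fun t _ => bdd_prod _ _ fun q _ => FF_bdd hf _

lemma eisSpan_expand (w : ℤ) (u : ℂ → ℂ) (hu : (fun z : UpperHalfPlane => u z) ∈ eisSpan w) :
    ∃ (S : Finset (ℕ × ℕ)) (C : ℕ × ℕ → ℂ), (∀ s ∈ S, 4 * (s.1 : ℤ) + 6 * (s.2 : ℤ) = w) ∧
      ∀ τ : ℂ, 0 < τ.im → u τ = ∑ s ∈ S, C s * (e4 τ ^ s.1 * e6 τ ^ s.2) := by
  unfold eisSpan at hu
  rw [Finsupp.mem_span_image_iff_linearCombination] at hu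
  obtain ⟨l, hl, hl2⟩ := hu
  refine ⟨l.support, l, fun s hs => ?_, fun τ hτ => ?_⟩
  · exact (Finsupp.mem_supported _ _).mp hl hs
  · have := congrFun hl2 (⟨τ, hτ⟩ : UpperHalfPlane)
    rw [Finsupp.linearCombination_apply, Finsupp.sum] at this
    rw [← this]
    simp [Finset.sum_apply, eisMono, e4, e6, UpperHalfPlane.ofComplex_apply_of_im_pos hτ]

/-- The polynomial relation. -/
theorem relA (hf : IsMF k f Γ) : ∃ (S : Finset (ℕ × ℕ × ℕ)) (C : ℕ × ℕ × ℕ → ℂ),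
    (∀ s ∈ S, 1 ≤ s.1 ∧ s.1 ≤ Fintype.card (SL2Z ⧸ Γ) ∧
      4 * (s.2.1 : ℤ) + 6 * (s.2.2 : ℤ) = k * s.1) ∧
    ∀ τ : ℂ, 0 < τ.im → ∀ X : ℂ, ∏ q : SL2Z ⧸ Γ, (X - FQ k f q τ) =
      X ^ Fintype.card (SL2Z ⧸ Γ) + ∑ s ∈ S, C s * (e4 τ ^ s.2.1 * e6 τ ^ s.2.2 *
        X ^ (Fintype.card (SL2Z ⧸ Γ) - s.1)) := by
  classical
  choose S C hS hC using fun e : ℕ => eisSpan_expand _ _ (sy_mem hf e)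
  set d := Fintype.card (SL2Z ⧸ Γ) with hd
  refine ⟨((Finset.Icc 1 d).sigma S).map (Equiv.sigmaEquivProd ℕ (ℕ × ℕ)).toEmbedding,
    fun s => (-1) ^ s.1 * C s.1 s.2, ?_, ?_⟩
  · intro s hs
    rw [Finset.mem_map] at hs
    obtain ⟨x, hx, rfl⟩ := hs
    rw [Finset.mem_sigma, Finset.mem_Icc] at hx
    exact ⟨hx.1.1, hx.1.2, hS _ _ hx.2⟩
  · intro τ hτ X
    rw [Finset.sum_map, Finset.sum_sigma, Finset.prod_sub, Finset.sum_powerset,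
      Finset.range_eq_Ico, Finset.sum_eq_sum_Ico_succ_bot (by omega)]
    congr 1
    · simp [hd]
    · refine Finset.sum_congr (by ext; simp [hd]) fun e he => ?_
      have h1 : ∀ t ∈ Finset.powersetCard e (Finset.univ : Finset (SL2Z ⧸ Γ)),
        (-1 : ℂ) ^ t.card * (∏ _i ∈ Finset.univ \ t, X) * ∏ i ∈ t, FQ k f i τ =
          (-1) ^ e * X ^ (d - e) * ∏ i ∈ t, FQ k f i τ := by
        intro t ht
        rw [Finset.mem_powersetCard] at ht
        rw [Finset.prod_const, ht.2, Finset.card_sdiff_of_subset (Finset.subset_univ _), ht.2,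
          Finset.card_univ]
      first
      | rw [Finset.sum_congr rfl h1]
      | (simp only [mul_assoc] at h1 ⊢; rw [Finset.sum_congr rfl h1])
      have h2 := hC e τ hτ
      unfold sy at h2
      simp only [← Finset.mul_sum, mul_assoc]
      rw [h2, Finset.mul_sum, Finset.mul_sum]
      refine Finset.sum_congr rfl fun s _ => ?_
      simp only [Equiv.sigmaEquivProd, Equiv.coe_toEmbedding, Equiv.coe_fn_mk]
      ring

end PartFour

section PartFive

/-- Decomposition of a product with an upper triangular matrix. -/
structure Dec (A B C : ℤ) (γ γ' : SL2Z) (α β δ : ℤ) : Prop where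
  e1 : A * γ.1 0 0 + B * γ.1 1 0 = γ'.1 0 0 * α
  e2 : A * γ.1 0 1 + B * γ.1 1 1 = γ'.1 0 0 * β + γ'.1 0 1 * δ
  e3 : C * γ.1 1 0 = γ'.1 1 0 * α
  e4 : C * γ.1 1 1 = γ'.1 1 0 * β + γ'.1 1 1 * δ

lemma Dec.mat {A B C : ℤ} {γ γ' : SL2Z} {α β δ : ℤ} (h : Dec A B C γ γ' α β δ) :
    !![A, B; 0, C] * γ.1 = γ'.1 * !![α, β; 0, δ] := by
  obtain ⟨h1, h2, h3, h4⟩ := h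
  ext i j
  fin_cases i <;> fin_cases j <;> simp [Matrix.mul_apply, Fin.sum_univ_two, h1, h2, h3, h4]

lemma Dec.of_mat {A B C : ℤ} {γ γ' : SL2Z} {α β δ : ℤ}
    (h : !![A, B; 0, C] * γ.1 = γ'.1 * !![α, β; 0, δ]) : Dec A B C γ γ' α β δ := by
  have h1 := congrFun (congrFun h 0) 0
  have h2 := congrFun (congrFun h 0) 1
  have h3 := congrFun (congrFun h 1) 0
  have h4 := congrFun (congrFun h 1) 1
  simp [Matrix.mul_apply, Fin.sum_univ_two] at h1 h2 h3 h4
  exact ⟨h1, h2, h3, h4⟩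

lemma det_SL (γ : SL2Z) : γ.1 0 0 * γ.1 1 1 - γ.1 0 1 * γ.1 1 0 = 1 := by
  have := γ.2
  rwa [Matrix.det_fin_two] at this

lemma exists_dec {A B C : ℤ} (hA : 0 < A) (hC : 0 < C) (γ : SL2Z) :
    ∃ (γ' : SL2Z) (α β δ : ℤ), Dec A B C γ γ' α β δ ∧ 0 < α ∧ 0 < δ ∧ α * δ = A * C ∧
      0 ≤ β ∧ β < δ := by
  have hdet := det_SL γ
  set a := γ.1 0 0
  set b := γ.1 0 1
  set c := γ.1 1 0
  set d := γ.1 1 1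
  set x := A * a + B * c with hx
  set y := C * c with hy
  set p := A * b + B * d with hp
  set s := C * d with hs
  have hN : x * s - p * y = A * C := by
    rw [hx, hy, hp, hs]
    linear_combination (A * C) * hdet
  have hAC : 0 < A * C := mul_pos hA hC
  have hg : 0 < Int.gcd x y := by
    rw [Int.gcd_pos_iff]
    by_contra! hcon
    rw [hcon.1, hcon.2] at hN
    simp at hN
    omega
  obtain ⟨x', y', hco, hx', hy'⟩ := Int.exists_gcd_one hg
  set α : ℤ := (Int.gcd x y : ℤ) with hα
  have hαp : 0 < α := Int.natCast_pos.mpr hg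
  obtain ⟨u, v, huv⟩ := (Int.isCoprime_iff_gcd_eq_one.mpr hco)
  set δ := x' * s - y' * p with hδ
  set β0 := u * p + v * s with hβ0
  have hαδ : α * δ = A * C := by
    rw [← hN, hδ, hx', hy']
    ring
  have hδp : 0 < δ := by
    by_contra! hcon
    nlinarith
  set m := β0 / δ
  have hm : β0 = β0 % δ + m * δ := by
    have := Int.emod_add_mul_ediv β0 δ
    linarith [mul_comm m δ]
  refine ⟨⟨!![x', m * x' - v; y', m * y' + u], ?_⟩, α, β0 % δ, δ, ⟨?_, ?_, ?_, ?_⟩, hαp, hδp, hαδ,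
    Int.emod_nonneg _ hδp.ne', Int.emod_lt_of_pos _ hδp⟩
  · rw [Matrix.det_fin_two_of]
    linear_combination huv
  · simpa using hx'
  · simp
    linear_combination (-p) * huv + x' * hm
  · simpa using hy'
  · simp
    linear_combination (-s) * huv + y' * hm

variable {A B C : ℤ} {γ γ' : SL2Z} {α β δ : ℤ}

lemma affine_im (hα : 0 < α) (hδ : 0 < δ) (τ : ℂ) :
    (((α : ℂ) * τ + β) / δ).im = (α : ℝ) / δ * τ.im := by
  have e : ((α : ℂ) * τ + β) / δ = (((α : ℝ) / δ : ℝ) : ℂ) * τ + (((β : ℝ) / δ : ℝ) : ℂ) := by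
    push_cast
    ring
  rw [e, Complex.add_im, Complex.im_ofReal_mul, Complex.ofReal_im, add_zero]

lemma affine_im_pos (hα : 0 < α) (hδ : 0 < δ) (τ : ℂ) (hτ : 0 < τ.im) :
    0 < (((α : ℂ) * τ + β) / δ).im := by
  rw [affine_im hα hδ]
  have h1 : (0 : ℝ) < α := by exact_mod_cast hα
  have h2 : (0 : ℝ) < δ := by exact_mod_cast hδ
  positivity

lemma Dec.den_eq (h : Dec A B C γ γ' α β δ) (hδ : 0 < δ) (τ : ℂ) :
    den γ' (((α : ℂ) * τ + β) / δ) = (C / δ : ℂ) * den γ τ := by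
  have h2 : (δ : ℂ) ≠ 0 := by exact_mod_cast hδ.ne'
  have h3 : (C : ℂ) * γ.1 1 0 = γ'.1 1 0 * α := by exact_mod_cast h.e3
  have h4 : (C : ℂ) * γ.1 1 1 = γ'.1 1 0 * β + γ'.1 1 1 * δ := by exact_mod_cast h.e4
  unfold den
  field_simp
  linear_combination (-τ) * h3 - h4

lemma Dec.acts_eq (h : Dec A B C γ γ' α β δ) (hC : 0 < C) (hα : 0 < α) (hδ : 0 < δ) (τ : ℂ)
    (hτ : 0 < τ.im) :
    ((A : ℂ) * acts γ τ + B) / C = acts γ' (((α : ℂ) * τ + β) / δ) := by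
  have hd := h.den_eq hδ τ
  have hne := den_ne_zero γ τ hτ
  have hC' : (C : ℂ) ≠ 0 := by exact_mod_cast hC.ne'
  have h0 : (δ : ℂ) ≠ 0 := by exact_mod_cast hδ.ne'
  have h1 : (A : ℂ) * γ.1 0 0 + B * γ.1 1 0 = γ'.1 0 0 * α := by exact_mod_cast h.e1
  have h2 : (A : ℂ) * γ.1 0 1 + B * γ.1 1 1 = γ'.1 0 0 * β + γ'.1 0 1 * δ := by
    exact_mod_cast h.e2
  have e1 : acts γ τ = ((γ.1 0 0 : ℂ) * τ + (γ.1 0 1 : ℂ)) / den γ τ := rfl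
  have e2 : acts γ' (((α : ℂ) * τ + β) / δ) =
    ((γ'.1 0 0 : ℂ) * (((α : ℂ) * τ + β) / δ) + (γ'.1 0 1 : ℂ)) / ((C / δ : ℂ) * den γ τ) := by
    rw [← hd]
    rfl
  rw [e1, e2]
  have e3 : den γ τ = (γ.1 1 0 : ℂ) * τ + (γ.1 1 1 : ℂ) := rfl
  field_simp
  rw [e3]
  linear_combination τ * h1 + h2

/-- The subgroup `Γ ∩ M⁻¹ Γ M`-type conjugate. -/
def conjGp (A B C : ℤ) (hA : 0 < A) (hC : 0 < C) (Γ : Subgroup SL2Z) : Subgroup SL2Z where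
  carrier := {γ | ∃ γ' ∈ Γ, !![A, B; 0, C] * γ.1 = γ'.1 * !![A, B; 0, C]}
  one_mem' := ⟨1, one_mem _, by simp⟩
  mul_mem' := by
    rintro x y ⟨x', hx', hx⟩ ⟨y', hy', hy⟩
    refine ⟨x' * y', mul_mem hx' hy', ?_⟩
    rw [Matrix.SpecialLinearGroup.coe_mul, Matrix.SpecialLinearGroup.coe_mul, ← Matrix.mul_assoc,
      hx, Matrix.mul_assoc, hy, Matrix.mul_assoc]
  inv_mem' := by
    rintro x ⟨x', hx', hx⟩
    refine ⟨x'⁻¹, inv_mem hx', ?_⟩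
    have h1 : x.1 * (x⁻¹).1 = 1 := by
      rw [← Matrix.SpecialLinearGroup.coe_mul, mul_inv_cancel, Matrix.SpecialLinearGroup.coe_one]
    have h2 : (x'⁻¹).1 * x'.1 = 1 := by
      rw [← Matrix.SpecialLinearGroup.coe_mul, inv_mul_cancel, Matrix.SpecialLinearGroup.coe_one]
    calc !![A, B; 0, C] * (x⁻¹).1 = ((x'⁻¹).1 * x'.1) * !![A, B; 0, C] * (x⁻¹).1 := by
          rw [h2, Matrix.one_mul]
      _ = (x'⁻¹).1 * (!![A, B; 0, C] * x.1) * (x⁻¹).1 := by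
          rw [hx]
          simp only [Matrix.mul_assoc]
      _ = (x'⁻¹).1 * !![A, B; 0, C] := by
          rw [Matrix.mul_assoc, Matrix.mul_assoc, h1, Matrix.mul_one]

lemma conjGp_index (hA : 0 < A) (hC : 0 < C) (Γ : Subgroup SL2Z) (hΓ : Γ.index ≠ 0) :
    (conjGp A B C hA hC Γ).index ≠ 0 := by
  have : Γ.FiniteIndex := ⟨hΓ⟩
  choose g' a b d hdec ha hd had hb hbd using fun γ : SL2Z => exists_dec (B := B) hA hC γ
  have hale : ∀ γ, a γ ∈ Set.Icc (0 : ℤ) (A * C) := fun γ =>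
    ⟨(ha γ).le, by nlinarith [had γ, ha γ, hd γ]⟩
  have hdle : ∀ γ, d γ ∈ Set.Icc (0 : ℤ) (A * C) := fun γ =>
    ⟨(hd γ).le, by nlinarith [had γ, ha γ, hd γ]⟩
  have hble : ∀ γ, b γ ∈ Set.Icc (0 : ℤ) (A * C) := fun γ =>
    ⟨hb γ, (hbd γ).le.trans (hdle γ).2⟩
  let Φ : SL2Z → Set.Icc (0 : ℤ) (A * C) × Set.Icc (0 : ℤ) (A * C) × Set.Icc (0 : ℤ) (A * C) ×
    (SL2Z ⧸ Γ) := fun γ => (⟨a γ, hale γ⟩, ⟨b γ, hble γ⟩, ⟨d γ, hdle γ⟩, ((g' γ)⁻¹ : SL2Z))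
  have hΦ : ∀ γ₁ γ₂, Φ γ₁ = Φ γ₂ → γ₁ * γ₂⁻¹ ∈ conjGp A B C hA hC Γ := by
    intro γ₁ γ₂ h
    simp only [Φ, Prod.mk.injEq, Subtype.mk.injEq] at h
    obtain ⟨h1, h2, h3, h4⟩ := h
    rw [QuotientGroup.eq, inv_inv] at h4
    refine ⟨_, h4, ?_⟩
    have m1 := (hdec γ₁).mat
    have m2 := (hdec γ₂).mat
    rw [← h1, ← h2, ← h3] at m2
    have i1 : γ₂.1 * (γ₂⁻¹).1 = 1 := by
      rw [← Matrix.SpecialLinearGroup.coe_mul, mul_inv_cancel, Matrix.SpecialLinearGroup.coe_one]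
    have i2 : ((g' γ₂)⁻¹).1 * (g' γ₂).1 = 1 := by
      rw [← Matrix.SpecialLinearGroup.coe_mul, inv_mul_cancel, Matrix.SpecialLinearGroup.coe_one]
    rw [Matrix.SpecialLinearGroup.coe_mul, Matrix.SpecialLinearGroup.coe_mul, ← Matrix.mul_assoc,
      m1]
    calc (g' γ₁).1 * !![a γ₁, b γ₁; 0, d γ₁] * (γ₂⁻¹).1
        = (g' γ₁).1 * (((g' γ₂)⁻¹).1 * (g' γ₂).1) * !![a γ₁, b γ₁; 0, d γ₁] * (γ₂⁻¹).1 := by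
          rw [i2, Matrix.mul_one]
      _ = (g' γ₁).1 * ((g' γ₂)⁻¹).1 * ((g' γ₂).1 * !![a γ₁, b γ₁; 0, d γ₁]) * (γ₂⁻¹).1 := by
          simp only [Matrix.mul_assoc]
      _ = (g' γ₁).1 * ((g' γ₂)⁻¹).1 * !![A, B; 0, C] := by
          rw [← m2]
          simp only [Matrix.mul_assoc]
          rw [i1, Matrix.mul_one]
  have : Finite (SL2Z ⧸ conjGp A B C hA hC Γ) := by
    refine Finite.of_injective (fun q => Φ (q.out)⁻¹) ?_
    intro q₁ q₂ h
    have := hΦ _ _ h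
    rw [inv_inv, ← QuotientGroup.eq, QuotientGroup.out_eq', QuotientGroup.out_eq'] at this
    exact this
  exact Subgroup.index_ne_zero_of_finite

theorem IsMF.affine (hA : 0 < A) (hC : 0 < C) {k : ℤ} {f : ℂ → ℂ} {Γ : Subgroup SL2Z}
    (hf : IsMF k f Γ) : IsMF k (fun τ => f (((A : ℂ) * τ + B) / C)) (conjGp A B C hA hC Γ) where
  hol τ hτ := by
    refine (hf.hol _ (affine_im_pos hA hC τ hτ)).comp (f := fun τ : ℂ => ((A : ℂ) * τ + B) / C) τ ?_
    fun_prop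
  tr := by
    rintro γ ⟨γ', hγ', h⟩ τ hτ
    have hdec := Dec.of_mat h
    have hC' : (C : ℂ) ≠ 0 := by exact_mod_cast hC.ne'
    rw [hdec.acts_eq hC hA hC τ hτ, hf.tr _ hγ' _ (affine_im_pos hA hC τ hτ), hdec.den_eq hC,
      div_self hC', one_mul]
  bdd := by
    intro γ
    obtain ⟨γ', α, β, δ, hdec, hα, hδ, -, -, -⟩ := exists_dec (B := B) hA hC γ
    obtain ⟨M, R, h⟩ := hf.bdd γ'
    have hα' : (0 : ℝ) < α := by exact_mod_cast hα
    have hδ' : (0 : ℝ) < δ := by exact_mod_cast hδ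
    refine ⟨‖((C / δ : ℂ)) ^ k‖ * M, (δ : ℝ) / α * R, fun τ hτ hR => ?_⟩
    have h1 := h _ (affine_im_pos (β := β) hα hδ τ hτ) (by
      rw [affine_im hα hδ]
      calc R = (α : ℝ) / δ * ((δ : ℝ) / α * R) := by field_simp
        _ ≤ _ := by gcongr)
    rw [hdec.acts_eq hC hα hδ τ hτ]
    rw [hdec.den_eq hδ, mul_zpow] at h1
    have hc : (C / δ : ℂ) ≠ 0 := by
      have hC' : (C : ℂ) ≠ 0 := by exact_mod_cast hC.ne'
      have hd' : (δ : ℂ) ≠ 0 := by exact_mod_cast hδ.ne'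
      exact div_ne_zero hC' hd'
    calc _ = ‖((C / δ : ℂ)) ^ k‖ * ‖(C / δ : ℂ) ^ (-k) * den γ τ ^ (-k) *
          f (acts γ' (((α : ℂ) * τ + β) / δ))‖ := by
          rw [← norm_mul, zpow_neg (C / δ : ℂ)]
          congr 1
          have := zpow_ne_zero k hc
          field_simp
      _ ≤ _ := by gcongr

end PartFive

section PartSix

open UpperHalfPlane ModularForm ModularFormClass MatrixGroups EisensteinSeries Filter Topology

lemma E_lim {k : ℕ} (hk : 3 ≤ k) (hk2 : Even k) :
    Tendsto (fun τ : ℂ => E hk (ofComplex τ)) (comap Complex.im atTop) (𝓝 1) := by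
  have h1 := ModularFormClass.analyticAt_cuspFunction_zero (E hk) one_pos
    one_mem_strictPeriods_SL
  have h2 : cuspFunction 1 (E hk) 0 = 1 := by
    have := E_qExpansion_coeff_zero hk hk2
    rw [qExpansion_coeff] at this
    simpa using this
  have h3 : Tendsto (E hk) atImInfty (𝓝 1) := by
    have h4 := h1.continuousAt.tendsto.comp (qParam_tendsto_atImInfty one_pos)
    rw [h2] at h4
    refine h4.congr fun τ => ?_
    exact SlashInvariantFormClass.eq_cuspFunction (E hk) τ one_mem_strictPeriods_SL one_ne_zero
  exact h3.comp tendsto_comap_im_ofComplex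

lemma e4_lim : Tendsto e4 (comap Complex.im atTop) (𝓝 1) := E_lim (by norm_num) ⟨2, rfl⟩
lemma e6_lim : Tendsto e6 (comap Complex.im atTop) (𝓝 1) := E_lim (by norm_num) ⟨3, rfl⟩

lemma e6_tr (γ : SL2Z) (τ : ℂ) (hτ : 0 < τ.im) : e6 (acts γ τ) = den γ τ ^ (6 : ℤ) * e6 τ := by
  have h := SlashInvariantForm.slash_action_eqn'' E₆
    (γ := (Matrix.SpecialLinearGroup.mapGL ℝ γ)) (Γ := 𝒮ℒ) (MonoidHom.mem_range.mpr ⟨γ, rfl⟩)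
    (⟨τ, hτ⟩ : ℍ)
  have h2 : ofComplex (acts γ τ) = γ • (⟨τ, hτ⟩ : ℍ) := by
    rw [ofComplex_apply_of_im_pos (acts_im_pos γ τ hτ)]
    ext
    rw [coe_smul_eq_acts]
  unfold e6
  rw [h2, ofComplex_apply_of_im_pos hτ]
  refine Eq.trans h ?_
  congr 2

lemma e6_hol (τ : ℂ) (hτ : 0 < τ.im) : DifferentiableAt ℂ e6 τ := by
  have := UpperHalfPlane.mdifferentiable_iff.mp (ModularFormClass.holo E₆)
  exact (this τ hτ).differentiableAt
    ((isOpen_lt continuous_const Complex.continuous_im).mem_nhds hτ)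

lemma e6_isMF : IsMF 6 e6 ⊤ where
  hol := e6_hol
  tr γ _ τ hτ := e6_tr γ τ hτ
  bdd γ := by
    have h := e6_lim.norm.eventually (eventually_le_nhds (by norm_num : ‖(1 : ℂ)‖ < 2))
    rw [eventually_comap] at h
    obtain ⟨A, hA⟩ := eventually_atTop.mp h
    refine ⟨2, A, fun τ hτ hτA => ?_⟩
    rw [e6_tr _ _ hτ, zpow_neg, inv_mul_cancel_left₀ (zpow_ne_zero _ (den_ne_zero _ _ hτ))]
    exact hA _ hτA τ rfl

/-- Descended relation satisfied by `f`. -/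
lemma relB {k : ℤ} {f : ℂ → ℂ} {Γ : Subgroup SL2Z} [Fintype (SL2Z ⧸ Γ)] (hf : IsMF k f Γ)
    {h : ℕ} (hh : 0 < h) (hq : QAlg h f) (φ : ℂ →ₗ[Qbar] Qbar)
    (hφ : ∀ x : Qbar, φ (x : ℂ) = x) (S : Finset (ℕ × ℕ × ℕ)) (C : ℕ × ℕ × ℕ → ℂ)
    (hrel : ∀ τ : ℂ, 0 < τ.im → ∀ X : ℂ, ∏ q : SL2Z ⧸ Γ, (X - FQ k f q τ) =
      X ^ Fintype.card (SL2Z ⧸ Γ) + ∑ s ∈ S, C s * (e4 τ ^ s.2.1 * e6 τ ^ s.2.2 *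
        X ^ (Fintype.card (SL2Z ⧸ Γ) - s.1))) :
    ∀ τ : ℂ, 0 < τ.im → f τ ^ Fintype.card (SL2Z ⧸ Γ) +
      ∑ s ∈ S, (φ (C s) : ℂ) * (e4 τ ^ s.2.1 * e6 τ ^ s.2.2 *
        f τ ^ (Fintype.card (SL2Z ⧸ Γ) - s.1)) = 0 := by
  refine descent hh φ hφ S C (fun s τ => e4 τ ^ s.2.1 * e6 τ ^ s.2.2 *
    f τ ^ (Fintype.card (SL2Z ⧸ Γ) - s.1)) (fun τ => f τ ^ Fintype.card (SL2Z ⧸ Γ)) ?_ (hq.pow _) ?_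
  · intro s _
    exact (((e4_QAlg hh).pow _).mul ((e6_QAlg hh).pow _)).mul (hq.pow _)
  · intro τ hτ
    rw [← hrel τ hτ]
    refine Finset.prod_eq_zero (Finset.mem_univ ((1 : SL2Z) : SL2Z ⧸ Γ)) ?_
    rw [FQ_mk hf _ _ hτ, FF_one, sub_self]

lemma mem_Qbar_of_root (P : Polynomial Qbar) (hP : P ≠ 0) (x : ℂ)
    (h : Polynomial.aeval x P = 0) : x ∈ Qbar := by
  have h1 : IsAlgebraic Qbar x := ⟨P, hP, h⟩
  have : Algebra.IsAlgebraic ℚ Qbar := algebraicClosure.isAlgebraic ℚ ℂ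
  rw [mem_Qbar]
  exact h1.restrictScalars ℚ

lemma mem_Qbar_of_pow {x : ℂ} {n : ℕ} (hn : 0 < n) (h : x ^ n ∈ Qbar) : x ∈ Qbar := by
  rw [mem_Qbar] at *
  exact IsAlgebraic.of_pow hn h

instance neBot_comap_im : (comap Complex.im atTop).NeBot := by
  refine Filter.comap_neBot fun t ht => ?_
  obtain ⟨a, ha⟩ := mem_atTop_sets.mp ht
  exact ⟨⟨0, a⟩, ha a le_rfl⟩

lemma eventually_im_pos : ∀ᶠ τ : ℂ in comap Complex.im atTop, 0 < τ.im :=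
  (eventually_gt_atTop (0 : ℝ)).comap _

lemma FQ_lim (N : ℕ) (hN : 0 < (N : ℤ)) (q : SL2Z ⧸ conjGp 1 0 N one_pos hN ⊤) :
    ∃ r : ℚ, 0 < r ∧ Tendsto (FQ 6 (fun τ => e6 ((((1 : ℤ) : ℂ) * τ + ((0 : ℤ) : ℂ)) / ((N : ℤ) : ℂ))) q)
      (comap Complex.im atTop) (𝓝 (r : ℂ)) := by
  obtain ⟨γ', α, β, δ, hdec, hα, hδ, -, -, -⟩ := exists_dec (B := 0) one_pos hN (q.out)⁻¹
  have hNq : (0 : ℚ) < N := by exact_mod_cast hN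
  have hδq : (0 : ℚ) < δ := by exact_mod_cast hδ
  refine ⟨((N : ℚ) / δ) ^ 6, by positivity, ?_⟩
  have hα' : (0 : ℝ) < α := by exact_mod_cast hα
  have hδ' : (0 : ℝ) < δ := by exact_mod_cast hδ
  have h1 : Tendsto (fun τ : ℂ => ((α : ℂ) * τ + β) / δ) (comap Complex.im atTop)
      (comap Complex.im atTop) := by
    rw [tendsto_comap_iff]
    have : (Complex.im ∘ fun τ : ℂ => ((α : ℂ) * τ + β) / δ) = fun τ => (α : ℝ) / δ * τ.im := by
      ext τ
      exact affine_im hα hδ τ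
    rw [this]
    exact tendsto_comap.const_mul_atTop (by positivity)
  have h2 := (e6_lim.comp h1).const_mul ((((N : ℚ) / δ) ^ 6 : ℚ) : ℂ)
  rw [mul_one] at h2
  refine h2.congr' ?_
  filter_upwards [eventually_im_pos] with τ hτ
  unfold FQ FF
  simp only [Function.comp]
  rw [hdec.acts_eq hN hα hδ τ hτ, e6_tr _ _ (affine_im_pos hα hδ τ hτ), hdec.den_eq hδ, mul_zpow,
    zpow_neg]
  have := den_ne_zero (q.out)⁻¹ τ hτ
  push_cast
  field_simp

set_option maxHeartbeats 1000000 in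
/-- The CM point computation. -/
theorem cm_alg (N : ℕ) (hN : 0 < N) (z0 : ℂ) (hz0 : z0 = ((Real.sqrt N : ℝ) : ℂ) * Complex.I) :
    ∃ Ω : ℂ, Ω ≠ 0 ∧ e4 z0 / Ω ^ 4 ∈ Qbar ∧ e6 z0 / Ω ^ 6 ∈ Qbar := by
  have hNZ : 0 < (N : ℤ) := by exact_mod_cast hN
  have hNr : (0 : ℝ) < N := by exact_mod_cast hN
  have hNc : (N : ℂ) ≠ 0 := by exact_mod_cast hN.ne'
  have him : 0 < z0.im := by
    rw [hz0]
    simpa using hNr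
  have hsq : z0 ^ 2 = -N := by
    rw [hz0, mul_pow, Complex.I_sq, ← Complex.ofReal_pow, Real.sq_sqrt hNr.le]
    simp
  have hz0ne : z0 ≠ 0 := by
    rintro h
    rw [h] at him
    simp at him
  obtain ⟨φ, hφ⟩ := exists_retraction
  set g : ℂ → ℂ := fun τ => e6 ((((1 : ℤ) : ℂ) * τ + ((0 : ℤ) : ℂ)) / ((N : ℤ) : ℂ)) with hg
  have hgMF : IsMF 6 g (conjGp 1 0 N one_pos hNZ ⊤) := e6_isMF.affine one_pos hNZ
  have hidx := conjGp_index (B := 0) one_pos hNZ ⊤ (by simp)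
  have : (conjGp 1 0 N one_pos hNZ ⊤).FiniteIndex := ⟨hidx⟩
  let _ : Fintype (SL2Z ⧸ conjGp 1 0 N one_pos hNZ ⊤) := Subgroup.fintypeQuotientOfFiniteIndex
  obtain ⟨S, C, hS, hrel⟩ := relA hgMF
  have hgq : QAlg N g := by
    have := (e6_QAlg one_pos).rescale one_pos one_pos hN 0 rfl
      (by simp only [mul_zero, zero_div, Complex.exp_zero]; exact one_mem _)
    rw [one_mul] at this
    have e : g = fun τ => e6 (0 + ((1 : ℕ) : ℂ) / N * τ) := by
      ext τ
      refine congrArg e6 ?_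
      push_cast
      ring
    rw [e]
    exact this
  have hB := relB hgMF hN hgq φ hφ S C hrel z0 him
  set d := Fintype.card (SL2Z ⧸ conjGp 1 0 N one_pos hNZ ⊤) with hd
  set M : ℚ := -(N : ℚ) ^ 3 with hM
  have hgz : g z0 = (M : ℂ) * e6 z0 := by
    have h1 := e6_tr ModularGroup.S z0 him
    have h2 : acts ModularGroup.S z0 = (((1 : ℤ) : ℂ) * z0 + ((0 : ℤ) : ℂ)) / ((N : ℤ) : ℂ) := by
      simp [acts, ModularGroup.S]
      field_simp
      linear_combination -hsq
    have h3 : den ModularGroup.S z0 = z0 := by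
      simp [den, ModularGroup.S]
    rw [h2, h3] at h1
    refine Eq.trans h1 ?_
    rw [hM]
    have : z0 ^ (6 : ℤ) = (z0 ^ 2) ^ 3 := by
      rw [← pow_mul]
      norm_cast
    rw [this, hsq]
    push_cast
    ring
  choose r hr hlim using FQ_lim N hNZ
  have hpoly : ∀ X : ℂ, ∏ q, (X - (r q : ℂ)) = X ^ d + ∑ s ∈ S, C s * X ^ (d - s.1) := by
    intro X
    have l1 : Tendsto (fun τ => ∏ q, (X - FQ 6 g q τ)) (comap Complex.im atTop)
        (𝓝 (∏ q, (X - (r q : ℂ)))) :=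
      tendsto_finsetProd _ fun q _ => tendsto_const_nhds.sub (hlim q)
    have l2 : Tendsto (fun τ => X ^ d + ∑ s ∈ S, C s * (e4 τ ^ s.2.1 * e6 τ ^ s.2.2 *
        X ^ (d - s.1))) (comap Complex.im atTop)
        (𝓝 (X ^ d + ∑ s ∈ S, C s * (1 ^ s.2.1 * 1 ^ s.2.2 * X ^ (d - s.1)))) := by
      refine tendsto_const_nhds.add (tendsto_finsetSum _ fun s _ => Tendsto.const_mul _ ?_)
      exact ((e4_lim.pow _).mul (e6_lim.pow _)).mul_const _
    have l3 := tendsto_nhds_unique (l1.congr' (by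
      filter_upwards [eventually_im_pos] with τ hτ using hrel τ hτ X)) l2
    simpa using l3
  have hMq : (M : ℂ) ∈ Qbar := mem_Qbar.mpr (isAlgebraic_algebraMap (R := ℚ) (A := ℂ) M)
  have hR1 : (M : ℂ) ^ d + ∑ s ∈ S, (φ (C s) : ℂ) * (M : ℂ) ^ (d - s.1) ≠ 0 := by
    have h1 : ∏ q, ((M : ℂ) - (r q : ℂ)) = ((∏ q, (M - r q) : ℚ) : ℂ) := by push_cast; rfl
    have h2 : ∏ q, (M - r q) ≠ 0 := by
      refine Finset.prod_ne_zero_iff.mpr fun q _ => ne_of_lt ?_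
      have := hr q
      have : (0 : ℚ) < (N : ℚ) ^ 3 := by positivity
      rw [hM]
      linarith
    have h3 := hpoly M
    rw [h1] at h3
    set P : ℚ := ∏ q, (M - r q)
    have hP : (P : ℂ) ∈ Qbar := mem_Qbar.mpr (isAlgebraic_algebraMap (R := ℚ) (A := ℂ) P)
    have h5 := congrArg (fun x => (φ x : ℂ)) h3
    simp only [map_add, map_sum, AddMemClass.coe_add, AddSubmonoidClass.coe_finsetSum] at h5
    have e1 : (φ (P : ℂ) : ℂ) = P := congrArg Subtype.val (hφ ⟨_, hP⟩)
    have e2 : (φ ((M : ℂ) ^ d) : ℂ) = (M : ℂ) ^ d :=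
      congrArg Subtype.val (hφ ⟨_, pow_mem hMq d⟩)
    have e3 : ∀ s ∈ S, (φ (C s * (M : ℂ) ^ (d - s.1)) : ℂ) = (φ (C s) : ℂ) * (M : ℂ) ^ (d - s.1) := by
      intro s _
      have := φ.map_smul (⟨_, pow_mem hMq (d - s.1)⟩ : Qbar) (C s)
      have h6 := congrArg (fun x : Qbar => (x : ℂ)) this
      simp only [smul_eq_mul, MulMemClass.coe_mul] at h6
      rw [mul_comm, mul_comm (φ (C s) : ℂ)]
      exact h6
    rw [e1, e2, Finset.sum_congr rfl e3] at h5
    rw [← h5]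
    exact_mod_cast h2
  -- the period
  have hdisc : e4 z0 ^ 3 - e6 z0 ^ 2 ≠ 0 := by
    have h1 := discriminant_ne_zero (⟨z0, him⟩ : ℍ)
    rw [discriminant_eq_E₄_cube_sub_E₆_sq] at h1
    unfold e4 e6
    rw [ofComplex_apply_of_im_pos him]
    intro h
    rw [h] at h1
    simp at h1
  obtain ⟨Ω, hΩ⟩ := IsAlgClosed.exists_pow_nat_eq (e4 z0 ^ 3 - e6 z0 ^ 2) (by norm_num : 0 < 12)
  have hΩ0 : Ω ≠ 0 := by
    rintro rfl
    rw [zero_pow (by norm_num)] at hΩ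
    exact hdisc hΩ.symm
  refine ⟨Ω, hΩ0, ?_⟩
  set x := e4 z0 / Ω ^ 4 with hx
  set y := e6 z0 / Ω ^ 6 with hy
  have hx' : e4 z0 = x * Ω ^ 4 := by rw [hx]; field_simp
  have hy' : e6 z0 = y * Ω ^ 6 := by rw [hy]; field_simp
  have hxy : x ^ 3 - y ^ 2 = 1 := by
    rw [hx', hy'] at hΩ
    have h12 : Ω ^ 12 ≠ 0 := pow_ne_zero _ hΩ0
    apply mul_right_cancel₀ h12
    linear_combination -hΩ
  have hfin : y ^ 2 ∈ Qbar → x ∈ Qbar ∧ y ∈ Qbar := by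
    intro h
    refine ⟨mem_Qbar_of_pow (n := 3) (by norm_num) ?_, mem_Qbar_of_pow (by norm_num) h⟩
    have : x ^ 3 = 1 + y ^ 2 := by linear_combination hxy
    rw [this]
    exact add_mem (one_mem _) h
  by_cases hy0 : y = 0
  · apply hfin
    rw [hy0]
    simp
  set t := x ^ 3 / y ^ 2 with ht
  have hroot : (M : ℂ) ^ d + ∑ s ∈ S, (φ (C s) : ℂ) * (M : ℂ) ^ (d - s.1) * t ^ (s.2.1 / 3) = 0 := by
    rw [hgz, hx', hy'] at hB
    have hne : (y * Ω ^ 6) ^ d ≠ 0 := pow_ne_zero _ (mul_ne_zero hy0 (pow_ne_zero _ hΩ0))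
    apply mul_right_cancel₀ hne
    rw [zero_mul, ← hB, add_mul, Finset.sum_mul]
    congr 1
    · ring
    · refine Finset.sum_congr rfl fun s hs => ?_
      obtain ⟨h1, h2, h3⟩ := hS s hs
      obtain ⟨e, a, b⟩ := s
      simp only at h1 h2 h3 ⊢
      obtain ⟨a', rfl⟩ : 3 ∣ a := by omega
      obtain ⟨j, hj⟩ := Nat.exists_eq_add_of_le h2
      rw [hj, Nat.add_sub_cancel_left, Nat.mul_div_cancel_left _ (by norm_num : 0 < 3)]
      have hb : e = b + 2 * a' := by omega
      rw [hb, ht, div_pow]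
      field_simp
      ring
  have htq : t ∈ Qbar := by
    refine mem_Qbar_of_root (Polynomial.C (⟨M, hMq⟩ ^ d) + ∑ s ∈ S,
      Polynomial.C (φ (C s) * ⟨M, hMq⟩ ^ (d - s.1)) * Polynomial.X ^ (s.2.1 / 3)) ?_ t ?_
    · intro h0
      have h1 := congrArg (Polynomial.aeval (1 : ℂ)) h0
      apply hR1
      simp only [map_add, map_sum, map_mul, map_pow, Polynomial.aeval_C, Polynomial.aeval_X, one_pow, mul_one, map_zero] at h1
      exact h1
    · rw [← hroot]
      simp only [map_add, map_sum, map_mul, map_pow, Polynomial.aeval_C, Polynomial.aeval_X]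
      rfl
  apply hfin
  have hy2 : y ^ 2 ≠ 0 := pow_ne_zero _ hy0
  have h1 : y ^ 2 * (t - 1) = 1 := by
    rw [ht]
    field_simp
    linear_combination hxy
  have h2 : y ^ 2 = (t - 1)⁻¹ := eq_inv_of_mul_eq_one_left h1
  rw [h2]
  exact inv_mem (sub_mem htq (one_mem _))

end PartSix

section PartSeven

lemma value_alg {k : ℤ} {f : ℂ → ℂ} {Γ : Subgroup SL2Z} (hΓ : Γ.index ≠ 0) (hf : IsMF k f Γ)
    {h : ℕ} (hh : 0 < h) (hq : QAlg h f) (z0 : ℂ) (him : 0 < z0.im) (Ω : ℂ) (hΩ : Ω ≠ 0)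
    (h4 : e4 z0 / Ω ^ 4 ∈ Qbar) (h6 : e6 z0 / Ω ^ 6 ∈ Qbar) : f z0 / Ω ^ k ∈ Qbar := by
  have : Γ.FiniteIndex := ⟨hΓ⟩
  let _ : Fintype (SL2Z ⧸ Γ) := Subgroup.fintypeQuotientOfFiniteIndex
  obtain ⟨φ, hφ⟩ := exists_retraction
  obtain ⟨S, C, hS, hrel⟩ := relA hf
  have hB := relB hf hh hq φ hφ S C hrel z0 him
  set d := Fintype.card (SL2Z ⧸ Γ) with hd
  set x := e4 z0 / Ω ^ 4 with hx
  set y := e6 z0 / Ω ^ 6 with hy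
  set w := f z0 / Ω ^ k with hw
  have hx' : e4 z0 = x * Ω ^ 4 := by rw [hx]; field_simp
  have hy' : e6 z0 = y * Ω ^ 6 := by rw [hy]; field_simp
  have hk0 : Ω ^ k ≠ 0 := zpow_ne_zero _ hΩ
  have hw' : f z0 = w * Ω ^ k := by rw [hw]; field_simp
  have hroot : w ^ d + ∑ s ∈ S, (φ (C s) : ℂ) * (x ^ s.2.1 * y ^ s.2.2) * w ^ (d - s.1) = 0 := by
    rw [hx', hy', hw'] at hB
    apply mul_right_cancel₀ (pow_ne_zero d hk0)
    rw [zero_mul, ← hB, add_mul, Finset.sum_mul]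
    congr 1
    · ring
    · refine Finset.sum_congr rfl fun s hs => ?_
      obtain ⟨h1, h2, h3⟩ := hS s hs
      obtain ⟨e, a, b⟩ := s
      simp only at h1 h2 h3 ⊢
      obtain ⟨j, hj⟩ := Nat.exists_eq_add_of_le h2
      rw [hj, Nat.add_sub_cancel_left]
      have e1 : (Ω ^ 4) ^ a * (Ω ^ 6) ^ b = (Ω ^ k) ^ e := by
        rw [← pow_mul, ← pow_mul, ← pow_add, ← zpow_natCast, ← zpow_natCast, ← zpow_mul, ← h3]
        push_cast
        rfl
      rw [mul_pow, mul_pow, mul_pow, pow_add (Ω ^ k) e j, ← e1]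
      ring
  refine mem_Qbar_of_root (Polynomial.X ^ d + ∑ s ∈ S,
      Polynomial.C (φ (C s) * (⟨x, h4⟩ ^ s.2.1 * ⟨y, h6⟩ ^ s.2.2)) * Polynomial.X ^ (d - s.1)) ?_ w ?_
  · intro h0
    have h1 := congrArg (fun P => Polynomial.coeff P d) h0
    simp only [Polynomial.coeff_add, Polynomial.finsetSum_coeff, Polynomial.coeff_C_mul,
      Polynomial.coeff_X_pow, if_true, Polynomial.coeff_zero] at h1
    rw [Finset.sum_eq_zero] at h1
    · simp at h1
    · intro s hs
      obtain ⟨h1, h2, h3⟩ := hS s hs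
      rw [if_neg (by omega), mul_zero]
  · rw [← hroot]
    simp only [map_add, map_sum, map_mul, map_pow, Polynomial.aeval_C, Polynomial.aeval_X]
    rfl

lemma rootOfUnity_mem (h : ℕ) (hh : 0 < h) (p : ℚ) :
    Complex.exp (2 * (Real.pi : ℂ) * Complex.I * (p : ℂ) / h) ∈ Qbar := by
  refine mem_Qbar_of_pow (n := h * p.den) (Nat.mul_pos hh p.den_pos) ?_
  have hh' : (h : ℂ) ≠ 0 := by exact_mod_cast hh.ne'
  have hd : (p.den : ℂ) ≠ 0 := by exact_mod_cast p.den_pos.ne'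
  have e : Complex.exp (2 * (Real.pi : ℂ) * Complex.I * (p : ℂ) / h) ^ (h * p.den) = 1 := by
    rw [← Complex.exp_nat_mul, Complex.exp_eq_one_iff]
    refine ⟨p.num, ?_⟩
    rw [Rat.cast_def]
    push_cast
    field_simp
  rw [e]
  exact one_mem _

end PartSeven

/-- For every imaginary quadratic field `K = ℚ(√D)`, `D < 0`, there is a period
`Ω_K ≠ 0` such that `f(z) ∈ 𝔔̄·Ω_K^k` for every `z ∈ K ∩ ℍ` and every holomorphic
modular form `f` of weight `k` for a finite-index subgroup `Γ ≤ SL(2,ℤ)`,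
holomorphic at all cusps, whose Fourier coefficients at `i∞` (with respect to the
width `h` of the cusp, i.e. `(1 h; 0 1) ∈ Γ`) are algebraic. -/
theorem cs_period_exists (D : ℤ) (hD : D < 0) :
    ∃ Ω : ℂ, Ω ≠ 0 ∧
      ∀ (k : ℤ) (f : ℂ → ℂ) (Γ : Subgroup SL2Z),
        Γ.index ≠ 0 →
        -- holomorphic on ℍ
        (∀ τ : ℂ, 0 < τ.im → DifferentiableAt ℂ f τ) →
        -- weight-k transformation law under Γ
        (∀ γ ∈ Γ, ∀ τ : ℂ, 0 < τ.im →
          f (acts γ τ) = ((γ.1 1 0 : ℂ) * τ + (γ.1 1 1 : ℂ)) ^ k * f τ) →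
        -- holomorphy (boundedness) at all cusps
        (∀ γ : SL2Z, ∃ M A : ℝ, ∀ τ : ℂ, A ≤ τ.im →
          ‖f (acts γ τ)‖ ≤
            M * ‖((γ.1 1 0 : ℂ) * τ + (γ.1 1 1 : ℂ)) ^ k‖) →
        -- Fourier expansion at i∞ with algebraic coefficients, h the width
        (∃ h : ℕ, 0 < h ∧ (∃ γ ∈ Γ, (γ : SL2Z).1 = !![1, (h : ℤ); 0, 1]) ∧
          ∃ a : ℕ → ℂ, (∀ n, IsAlgebraic ℚ (a n)) ∧
            ∀ τ : ℂ, 0 < τ.im →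
              Summable (fun n : ℕ =>
                a n * Complex.exp (2 * (Real.pi : ℂ) * Complex.I * (n : ℂ) * τ / (h : ℂ))) ∧
              f τ = ∑' n : ℕ,
                a n * Complex.exp (2 * (Real.pi : ℂ) * Complex.I * (n : ℂ) * τ / (h : ℂ))) →
        -- value at a point of K ∩ ℍ
        ∀ z : ℂ, 0 < z.im →
          (∃ p q : ℚ, z = (p : ℂ) + (q : ℂ) * ((Real.sqrt (-(D : ℝ)) : ℝ) : ℂ) * Complex.I) →
          ∃ c : ℂ, IsAlgebraic ℚ c ∧ f z = c * Ω ^ k := by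
  obtain ⟨N, hND⟩ := Int.eq_ofNat_of_zero_le (by omega : 0 ≤ -D)
  have hN : 0 < N := by omega
  have hNr : (0 : ℝ) < N := by exact_mod_cast hN
  have hDr : -(D : ℝ) = N := by exact_mod_cast congrArg (fun x : ℤ => (x : ℝ)) hND
  obtain ⟨Ω, hΩ, h4, h6⟩ := cm_alg N hN _ rfl
  set z0 : ℂ := ((Real.sqrt N : ℝ) : ℂ) * Complex.I with hz0
  have hsqrt : 0 < Real.sqrt N := Real.sqrt_pos.mpr hNr
  have him : 0 < z0.im := by
    rw [hz0]
    simpa using hNr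
  refine ⟨Ω, hΩ, ?_⟩
  rintro k f Γ hΓ hol htr hbd ⟨h, hh, -, a, ha, hexp⟩ z hz ⟨p, q, hpq⟩
  rw [hDr, mul_assoc, ← hz0] at hpq
  have hf : IsMF k f Γ := by
    refine ⟨hol, htr, fun γ => ?_⟩
    obtain ⟨M, A, hMA⟩ := hbd γ
    refine ⟨M, A, fun τ hτ hA => ?_⟩
    have hpos : 0 < ‖den γ τ ^ k‖ := norm_pos_iff.mpr (zpow_ne_zero _ (den_ne_zero γ τ hτ))
    have h1 : ‖f (acts γ τ)‖ ≤ M * ‖den γ τ ^ k‖ := hMA τ hA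
    rw [zpow_neg, norm_mul, norm_inv, inv_mul_le_iff₀ hpos, mul_comm]
    exact h1
  have hfq : QAlg h f := by
    refine ⟨PowerSeries.mk a, fun n => ?_, fun τ hτ => ?_⟩
    · rw [PowerSeries.coeff_mk, mem_Qbar]
      exact ha n
    · obtain ⟨h1, h2⟩ := hexp τ hτ
      have h3 := h1.hasSum
      rw [← h2] at h3
      convert! h3 using 1
      ext n
      rw [PowerSeries.coeff_mk, qw, ← Complex.exp_nat_mul]
      congr 2
      ring
  have hqpos : 0 < q := by
    have h1 : z.im = (q : ℝ) * Real.sqrt N := by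
      have e : z = ((p : ℝ) : ℂ) + ((q : ℝ) : ℂ) * z0 := by
        rw [hpq]
        push_cast
        rfl
      rw [e, Complex.add_im, Complex.ofReal_im, zero_add, Complex.im_ofReal_mul, hz0]
      simp
    rw [h1] at hz
    have := pos_of_mul_pos_left hz hsqrt.le
    exact_mod_cast this
  -- common denominator
  have hAp : 0 < q.num.toNat * p.den :=
    Nat.mul_pos (by have := Rat.num_pos.mpr hqpos; omega) p.den_pos
  have hCp : 0 < q.den * p.den := Nat.mul_pos q.den_pos p.den_pos
  set A : ℕ := q.num.toNat * p.den with hA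
  set C : ℕ := q.den * p.den with hC
  set B : ℤ := p.num * q.den with hB
  have hCc : (C : ℂ) ≠ 0 := by exact_mod_cast hCp.ne'
  have hq1 : (q : ℂ) = (A : ℂ) / C := by
    have hn : ((q.num.toNat : ℕ) : ℂ) = (q.num : ℂ) := by
      have : ((q.num.toNat : ℕ) : ℤ) = q.num := Int.toNat_of_nonneg (Rat.num_pos.mpr hqpos).le
      exact_mod_cast congrArg (fun x : ℤ => (x : ℂ)) this
    have hd : (p.den : ℂ) ≠ 0 := by exact_mod_cast p.den_pos.ne'
    rw [hA, hC, Rat.cast_def]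
    push_cast
    rw [hn, mul_div_mul_right _ _ hd]
  have hp1 : (p : ℂ) = (B : ℂ) / C := by
    have hd : (q.den : ℂ) ≠ 0 := by exact_mod_cast q.den_pos.ne'
    rw [hB, hC, Rat.cast_def]
    push_cast
    rw [mul_comm (q.den : ℂ), mul_div_mul_right _ _ hd]
  have hAZ : 0 < (A : ℤ) := by exact_mod_cast hAp
  have hCZ : 0 < (C : ℤ) := by exact_mod_cast hCp
  have hgMF := hf.affine (B := B) hAZ hCZ
  have hgi := conjGp_index (B := B) hAZ hCZ Γ hΓ
  have haff : ∀ τ : ℂ, (((A : ℤ) : ℂ) * τ + (B : ℂ)) / ((C : ℤ) : ℂ) = (p : ℂ) + A / C * τ := by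
    intro τ
    rw [hp1]
    push_cast
    ring
  simp only [haff] at hgMF
  have hgq := hfq.rescale hh hAp hCp (p : ℂ) (by simp) (rootOfUnity_mem h hh p)
  have key := value_alg hgi hgMF (Nat.mul_pos hh hCp) hgq z0 him Ω hΩ h4 h6
  rw [← hq1, ← hpq] at key
  refine ⟨_, mem_Qbar.mp key, ?_⟩
  have hk0 : Ω ^ k ≠ 0 := zpow_ne_zero _ hΩ
  field_simp
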